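/- Let G be a connected graph all of whose blocks are Hamiltonian graphs of odd order (and each block is 2-connected). Then for every vertex v of G, there exists a matching M of G that covers all vertices of G except exactly v. -/

import Mathlib

/-- `B` induces a subgraph of `G` with no cut-vertex: removing any single vertex of `B` leaves the
induced graph preconnected. -/
def NoCutVertex {V : Type*} [DecidableEq V] (G : SimpleGraph V) (B : Finset V) : Prop :=
  ∀ v ∈ B, (G.induce ((B.erase v : Finset V) : Set V)).Preconnected

/-- `B` is (the vertex set of) a block of `G`: a maximal vertex subset inducing a connected
subgraph with no cut-vertex. -/
def IsBlock {V : Type*} [DecidableEq V] (G : SimpleGraph V) (B : Finset V) : Prop :=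
  B.Nonempty ∧ (G.induce (B : Set V)).Preconnected ∧ NoCutVertex G B ∧
    ∀ C : Finset V, B ⊆ C → (G.induce (C : Set V)).Preconnected → NoCutVertex G C → B = C

/-- `y` can be reached from `x` along a walk of `G` that stays inside `A`. -/
def ReachableIn {V : Type*} (G : SimpleGraph V) (A : Set V) (x y : V) : Prop :=
  ∃ p : G.Walk x y, ∀ z ∈ p.support, z ∈ A

namespace ReachableIn

variable {V : Type*} {G : SimpleGraph V} {A A' : Set V} {x y z : V}

lemma refl (hx : x ∈ A) : ReachableIn G A x x :=
  ⟨.nil, by simpa using hx⟩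

lemma symm (h : ReachableIn G A x y) : ReachableIn G A y x := by
  obtain ⟨p, hp⟩ := h
  exact ⟨p.reverse, by simpa using hp⟩

lemma trans (h : ReachableIn G A x y) (h' : ReachableIn G A y z) : ReachableIn G A x z := by
  obtain ⟨p, hp⟩ := h
  obtain ⟨q, hq⟩ := h'
  refine ⟨p.append q, fun w hw => ?_⟩
  rw [SimpleGraph.Walk.mem_support_append_iff] at hw
  exact hw.elim (hp w) (hq w)

lemma mono (h : ReachableIn G A x y) (hA : A ⊆ A') : ReachableIn G A' x y := by
  obtain ⟨p, hp⟩ := h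
  exact ⟨p, fun z hz => hA (hp z hz)⟩

lemma of_adj (h : G.Adj x y) (hx : x ∈ A) (hy : y ∈ A) : ReachableIn G A x y :=
  ⟨h.toWalk, by simp [hx, hy]⟩

/-- A walk from outside `S` into `S` has a first vertex in `S`. -/
lemma exists_first_mem {S : Set V} (h : ReachableIn G A x y) (hx : x ∉ S) (hy : y ∈ S) :
    ∃ u ∉ S, ∃ t ∈ S, t ∈ A ∧ G.Adj t u ∧ ReachableIn G Sᶜ x u := by
  obtain ⟨p, hp⟩ := h
  induction p with
  | nil => exact absurd hy hx
  | @cons a b c hab p ih =>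
    by_cases hb : b ∈ S
    · exact ⟨a, hx, b, hb, hp b (by simp), hab.symm, refl hx⟩
    · obtain ⟨u, hu, t, ht, htA, htu, hr⟩ := ih hb hy fun z hz => hp z (by simp [hz])
      exact ⟨u, hu, t, ht, htA, htu, (of_adj hab hx hb).trans hr⟩

end ReachableIn

section

variable {V : Type*} {G : SimpleGraph V}

lemma preconnected_induce_iff_reachableIn {A : Set V} :
    (G.induce A).Preconnected ↔ ∀ x ∈ A, ∀ y ∈ A, ReachableIn G A x y := by
  constructor
  · intro h x hx y hy
    obtain ⟨p⟩ := h ⟨x, hx⟩ ⟨y, hy⟩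
    have hp : ∀ z ∈ (p.map (SimpleGraph.Embedding.induce A).toHom).support, z ∈ A := by
      intro z hz
      rw [SimpleGraph.Walk.support_map, List.mem_map] at hz
      obtain ⟨w, -, rfl⟩ := hz
      exact w.2
    exact ⟨_, hp⟩
  · rintro h ⟨x, hx⟩ ⟨y, hy⟩
    obtain ⟨p, hp⟩ := h x hx y hy
    exact ⟨p.induce A hp⟩

lemma preconnected_induce_of_reachableIn {A : Set V} (c : V)
    (h : ∀ x ∈ A, ReachableIn G A x c) : (G.induce A).Preconnected :=
  preconnected_induce_iff_reachableIn.2 fun x hx y hy => (h x hx).trans (h y hy).symm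

lemma exists_isMatching_verts_eq_of_isChain : ∀ l : List V, l.IsChain G.Adj → l.Nodup →
    Even l.length → ∃ M : G.Subgraph, M.IsMatching ∧ M.verts = {v | v ∈ l}
  | [], _, _, _ => ⟨⊥, by simp [SimpleGraph.Subgraph.IsMatching], by simp⟩
  | [_], _, _, h => by simp at h
  | a :: b :: l, hc, hn, he => by
    obtain ⟨M, hM, hv⟩ := exists_isMatching_verts_eq_of_isChain l hc.tail.tail
      (by simp_all) (by simpa [Nat.even_add_one] using he)
    have hab : G.Adj a b := by simpa using hc.rel
    refine ⟨G.subgraphOfAdj hab ⊔ M,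
      (SimpleGraph.Subgraph.IsMatching.subgraphOfAdj hab).sup hM ?_, ?_⟩
    · rw [hM.support_eq_verts,
        (SimpleGraph.Subgraph.IsMatching.subgraphOfAdj hab).support_eq_verts, hv]
      rw [Set.disjoint_left]
      intro u hu hul
      simp only [SimpleGraph.subgraphOfAdj_verts, Set.mem_insert_iff,
        Set.mem_singleton_iff] at hu
      simp only [List.nodup_cons, List.mem_cons, not_or] at hn
      rcases hu with rfl | rfl
      · exact hn.1.2 hul
      · exact hn.2.1 hul
    · ext u
      simp [hv, or_assoc]

variable [DecidableEq V]

/-- Attaching an ear to a vertex set without cut-vertex creates no cut-vertex. -/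
lemma noCutVertex_union_support {B : Finset V} (hB : (G.induce (B : Set V)).Preconnected)
    (hB' : NoCutVertex G B) {p q x y : V} (hp : p ∈ B) (hq : q ∈ B) (hpq : p ≠ q)
    (hpx : G.Adj p x) (hqy : G.Adj q y) {w : G.Walk x y} (hw : w.IsPath)
    (hwB : ∀ z ∈ w.support, z ∉ B) :
    (G.induce ((B ∪ w.support.toFinset : Finset V) : Set V)).Preconnected ∧
      NoCutVertex G (B ∪ w.support.toFinset) := by
  have toStart : ∀ z ∈ w.support, ReachableIn G {u | u ∈ w.support} z x := fun z hz =>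
    ReachableIn.symm ⟨w.takeUntil z hz, fun u hu => w.support_takeUntil_subset_support hz hu⟩
  have toEnd : ∀ z ∈ w.support, ReachableIn G {u | u ∈ w.support} z y := fun z hz =>
    ⟨w.dropUntil z hz, fun u hu => w.support_dropUntil_subset_support hz hu⟩
  have hxw := w.start_mem_support
  have hyw := w.end_mem_support
  rw [preconnected_induce_iff_reachableIn] at hB
  constructor
  · refine preconnected_induce_of_reachableIn p fun z hz => ?_
    simp only [Finset.coe_union, Set.mem_union, Finset.mem_coe, List.mem_toFinset] at hz
    rcases hz with hz | hz
    · exact (hB z hz p hp).mono (by simp)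
    · refine ((toStart z hz).mono ?_).trans (.of_adj hpx.symm (by simp) (by simp [hp]))
      intro u hu
      simpa using Or.inr hu
  intro r hr
  have hBr : ∀ r ∈ B, ∀ c ∈ B, c ≠ r → ∀ z ∈ B, z ≠ r →
      ReachableIn G ((B.erase r : Finset V) : Set V) z c := fun r hr c hc hcr z hz hzr =>
    preconnected_induce_iff_reachableIn.1 (hB' r hr) z (by simp [hz, hzr]) c (by simp [hc, hcr])
  rw [Finset.mem_union, List.mem_toFinset] at hr
  by_cases hrB : r ∈ B
  · have hsub : {u | u ∈ w.support} ⊆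
        (((B ∪ w.support.toFinset).erase r : Finset V) : Set V) := by
      intro u hu
      have : u ≠ r := fun h => hwB u hu (h ▸ hrB)
      simpa [this] using Or.inr hu
    have hsub' : ((B.erase r : Finset V) : Set V) ⊆
        (((B ∪ w.support.toFinset).erase r : Finset V) : Set V) :=
      Finset.coe_subset.2 (Finset.erase_subset_erase _ Finset.subset_union_left)
    by_cases hrp : p = r
    · have hqr : q ≠ r := fun h => hpq (hrp.trans h.symm)
      refine preconnected_induce_of_reachableIn q fun z hz => ?_
      simp only [Finset.mem_coe, Finset.mem_erase, Finset.mem_union, List.mem_toFinset] at hz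
      rcases hz with ⟨hzr, hz | hz⟩
      · exact (hBr r hrB q hq hqr z hz hzr).mono hsub'
      · exact ((toEnd z hz).mono hsub).trans
          (.of_adj hqy.symm (hsub hyw) (hsub' (by simp [hq, hqr])))
    · refine preconnected_induce_of_reachableIn p fun z hz => ?_
      simp only [Finset.mem_coe, Finset.mem_erase, Finset.mem_union, List.mem_toFinset] at hz
      rcases hz with ⟨hzr, hz | hz⟩
      · exact (hBr r hrB p hp hrp z hz hzr).mono hsub'
      · exact ((toStart z hz).mono hsub).trans
          (.of_adj hpx.symm (hsub hxw) (hsub' (by simp [hp, hrp])))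
  · have hrw : r ∈ w.support := hr.resolve_left hrB
    have hsub' : (B : Set V) ⊆ (((B ∪ w.support.toFinset).erase r : Finset V) : Set V) := by
      intro u hu
      have : u ≠ r := fun h => hrB (h ▸ hu)
      simpa [this] using Or.inl hu
    refine preconnected_induce_of_reachableIn p fun z hz => ?_
    simp only [Finset.mem_coe, Finset.mem_erase, Finset.mem_union, List.mem_toFinset] at hz
    rcases hz with ⟨hzr, hz | hz⟩
    · exact (hB z hz p hp).mono hsub'
    by_cases hrt : r ∈ (w.takeUntil z hz).support
    · have hrd : r ∉ (w.dropUntil z hz).support := fun hrd => by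
        rw [← w.take_spec hz] at hw
        exact hw.ne_of_mem_support_of_append hzr.symm hrt hrd rfl
      have hsub : ∀ u ∈ (w.dropUntil z hz).support,
          u ∈ (((B ∪ w.support.toFinset).erase r : Finset V) : Set V) := fun u hu => by
        have : u ≠ r := fun h => hrd (h ▸ hu)
        simpa [this] using Or.inr (w.support_dropUntil_subset_support hz hu)
      exact (ReachableIn.trans ⟨_, hsub⟩
        (.of_adj hqy.symm (hsub _ (SimpleGraph.Walk.end_mem_support _)) (hsub' hq))).trans
        ((hB q hq p hp).mono hsub')
    · have hsub : ∀ u ∈ (w.takeUntil z hz).support,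
          u ∈ (((B ∪ w.support.toFinset).erase r : Finset V) : Set V) := fun u hu => by
        have : u ≠ r := fun h => hrt (h ▸ hu)
        simpa [this] using Or.inr (w.support_takeUntil_subset_support hz hu)
      exact (ReachableIn.symm ⟨_, hsub⟩).trans
        (.of_adj hpx.symm (hsub _ (SimpleGraph.Walk.start_mem_support _)) (hsub' hp))

/-- A walk avoiding a block is attached to it at no more than one vertex. -/
lemma IsBlock.eq_of_reachableIn_compl {B : Finset V} (hB : IsBlock G B) {p q x y : V}
    (hp : p ∈ B) (hq : q ∈ B) (hpx : G.Adj p x) (hqy : G.Adj q y)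
    (h : ReachableIn G (B : Set V)ᶜ x y) : p = q := by
  by_contra hpq
  obtain ⟨w, hw⟩ := h
  have hw' : ∀ z ∈ w.bypass.support, z ∉ B := fun z hz =>
    hw z (w.support_bypass_subset_support hz)
  obtain ⟨h₁, h₂⟩ :=
    noCutVertex_union_support hB.2.1 hB.2.2.1 hp hq hpq hpx hqy w.bypass_isPath hw'
  have hx := w.bypass.start_mem_support
  have heq := hB.2.2.2 _ Finset.subset_union_left h₁ h₂
  refine hw' x hx ?_
  rw [heq]
  simp

lemma exists_isBlock_of_adj [Finite V] {s t : V} (h : G.Adj s t) :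
    ∃ B : Finset V, IsBlock G B ∧ s ∈ B ∧ t ∈ B := by
  obtain ⟨B, hB, hmax⟩ := Finite.exists_le_maximal (a := ({s, t} : Finset V))
    (p := fun C : Finset V => (G.induce (C : Set V)).Preconnected ∧ NoCutVertex G C) <| by
      constructor
      · refine preconnected_induce_of_reachableIn s fun x hx => ?_
        obtain rfl | rfl : x = s ∨ x = t := by simpa using hx
        · exact .refl hx
        · exact .of_adj h.symm hx (by simp)
      · intro v hv
        rw [preconnected_induce_iff_reachableIn]
        intro x hx y hy
        have hxy : x = y := by
          simp only [Finset.coe_erase, Finset.coe_insert, Finset.coe_singleton, Set.mem_sdiff,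
            Set.mem_insert_iff, Set.mem_singleton_iff, Finset.mem_insert,
            Finset.mem_singleton] at hx hy hv
          grind
        exact hxy ▸ .refl hx
  have hs : s ∈ B := hB (by simp)
  exact ⟨B, ⟨⟨s, hs⟩, hmax.prop.1, hmax.prop.2,
    fun C hBC h₁ h₂ => hmax.eq_of_le ⟨h₁, h₂⟩ hBC⟩, hs, hB (by simp)⟩

/-- An odd Hamiltonian graph has a near-perfect matching excluding any given vertex. -/
lemma exists_isMatching_of_isHamiltonian {W : Type*} [Fintype W] [DecidableEq W]
    {H : SimpleGraph W} (hH : H.IsHamiltonian) (hodd : Odd (Fintype.card W)) (s : W) :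
    ∃ M : H.Subgraph, M.IsMatching ∧ M.verts = Set.univ \ {s} := by
  by_cases hW : Nontrivial W
  · obtain ⟨c, hc⟩ := hH.exists_isHamiltonianCycle s
    have hp := hc.isHamiltonian_tail
    set p := c.tail.reverse
    have hsupp : p.support = c.tail.support.reverse := c.tail.support_reverse
    have hcons : p.support = s :: p.support.tail := p.cons_tail_support.symm
    have hmem : ∀ z, z ∈ p.support := fun z => by simp [hsupp, hp.mem_support z]
    have hnodup : p.support.Nodup := by
      rw [hsupp, List.nodup_reverse]
      exact hp.isPath.support_nodup
    have hlen : p.support.length = Fintype.card W := by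
      rw [hsupp, List.length_reverse, hp.length_support]
    obtain ⟨M, hM, hv⟩ := exists_isMatching_verts_eq_of_isChain p.support.tail
      p.isChain_adj_support.tail hnodup.tail (by
        rw [List.length_tail, hlen]
        exact hodd.tsub_odd odd_one)
    refine ⟨M, hM, ?_⟩
    rw [hcons, List.nodup_cons] at hnodup
    ext z
    have hz := hmem z
    rw [hcons, List.mem_cons] at hz
    simp only [hv, Set.mem_ofPred_eq, Set.mem_sdiff, Set.mem_univ, true_and,
      Set.mem_singleton_iff]
    exact ⟨fun h hzs => hnodup.1 (hzs ▸ h), hz.resolve_left⟩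
  · rw [not_nontrivial_iff_subsingleton] at hW
    refine ⟨⊥, by simp [SimpleGraph.Subgraph.IsMatching], ?_⟩
    ext z
    simp [Subsingleton.elim z s]

lemma exists_isMatching_verts_eq_sdiff {B : Finset V}
    (hH : (G.induce (B : Set V)).IsHamiltonian) (hodd : Odd B.card) {s : V} (hs : s ∈ B) :
    ∃ M : G.Subgraph, M.IsMatching ∧ M.verts = (B : Set V) \ {s} := by
  obtain ⟨M, hM, hv⟩ := exists_isMatching_of_isHamiltonian hH (by simpa using hodd) ⟨s, hs⟩
  refine ⟨M.map (SimpleGraph.Embedding.induce (B : Set V)).toHom,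
    hM.map _ Subtype.val_injective, ?_⟩
  ext z
  simp [hv, and_comm]

end

/-- In a connected graph all of whose blocks are 2-connected Hamiltonian graphs of odd order,
every vertex `v` is missed by some near-perfect matching. -/
theorem stmt_6 {V : Type*} [Fintype V] [DecidableEq V] (G : SimpleGraph V)
    (hconn : G.Connected)
    (hblocks : ∀ B : Finset V, IsBlock G B →
      (G.induce (B : Set V)).IsHamiltonian ∧ Odd B.card ∧ 3 ≤ B.card) :
    ∀ v : V, ∃ M : G.Subgraph, M.IsMatching ∧ M.verts = Set.univ \ {v} := by
  intro v
  obtain ⟨S, -, hmax⟩ := Finite.exists_le_maximal (a := ({v} : Set V))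
    (p := fun S : Set V => v ∈ S ∧
      (∃ M : G.Subgraph, M.IsMatching ∧ M.verts = S \ {v}) ∧
      ∀ s ∈ S, ∀ t ∈ S, ∀ x ∉ S, ∀ y ∉ S, G.Adj s x → G.Adj t y →
        ReachableIn G Sᶜ x y → s = t) <| by
      refine ⟨rfl, ⟨⊥, by simp [SimpleGraph.Subgraph.IsMatching], by simp⟩, ?_⟩
      rintro s rfl t rfl
      simp
  obtain ⟨hvS, ⟨M, hM, hMv⟩, hinv⟩ := hmax.prop
  suffices hS : S = Set.univ from ⟨M, hM, hS ▸ hMv⟩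
  by_contra hS
  obtain ⟨u, hu⟩ := (Set.ne_univ_iff_exists_notMem S).1 hS
  obtain ⟨p⟩ := hconn.preconnected v u
  obtain ⟨d, -, hs, hw⟩ := p.exists_boundary_dart S hvS hu
  obtain ⟨⟨s, w⟩, hsw⟩ := d
  simp only at hs hw hsw
  obtain ⟨B, hB, hsB, hwB⟩ := exists_isBlock_of_adj hsw
  have hBs : ∀ a ∈ B, a ≠ s → ∀ b ∈ B, b ≠ s →
      ReachableIn G ((B.erase s : Finset V) : Set V) a b := fun a ha has b hb hbs =>
    preconnected_induce_iff_reachableIn.1 (hB.2.2.1 s hsB) a (by simp [ha, has])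
      b (by simp [hb, hbs])
  have hws : w ≠ s := fun h => hw (h ▸ hs)
  have hBS : ∀ t ∈ B, t ∈ S → t = s := by
    intro t ht htS
    by_contra hts
    obtain ⟨y, hy, t', ht', htB, hty, hr⟩ :=
      (hBs w hwB hws t ht hts).exists_first_mem hw htS
    have := hinv s hs t' ht' w hw y hy hsw hty hr
    simp [this] at htB
  obtain ⟨hH, hodd, -⟩ := hblocks B hB
  obtain ⟨N, hN, hNv⟩ := exists_isMatching_verts_eq_sdiff hH hodd hsB
  have key : ∀ a ∈ B, a ∉ S → ∀ t ∈ S, ∀ x ∉ S ∪ (B : Set V), ∀ y ∉ S ∪ (B : Set V),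
      G.Adj a x → G.Adj t y → ReachableIn G (S ∪ (B : Set V))ᶜ x y → t = s := by
    intro a ha haS t ht x hx y hy hax hty hr
    have has : a ≠ s := fun h => haS (h ▸ hs)
    have hwa : ReachableIn G Sᶜ w a := (hBs w hwB hws a ha has).mono fun z hz hzS => by
      rw [Finset.mem_coe, Finset.mem_erase] at hz
      exact hz.1 (hBS z hz.2 hzS)
    have hxS : x ∉ S := fun h => hx (.inl h)
    exact (hinv s hs t ht w hw y (fun h => hy (.inl h)) hsw hty
      ((hwa.trans (.of_adj hax haS hxS)).trans
        (hr.mono (Set.compl_subset_compl.2 Set.subset_union_left)))).symm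
  have hext := hmax.le_of_ge (y := S ∪ (B : Set V)) ⟨.inl hvS, ⟨M ⊔ N, hM.sup hN ?_, ?_⟩, ?_⟩
    Set.subset_union_left
  · exact hw (hext (.inr hwB))
  · rw [hM.support_eq_verts, hN.support_eq_verts, hMv, hNv, Set.disjoint_left]
    exact fun z hz hz' => hz'.2 (hBS z hz'.1 hz.1)
  · ext z
    have := hBS z
    have := hBS v
    simp only [SimpleGraph.Subgraph.verts_sup, hMv, hNv, Set.mem_union, Set.mem_sdiff,
      Set.mem_singleton_iff, Finset.mem_coe]
    grind
  · intro a ha b hb x hx y hy hax hby hr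
    have hblock : a ∈ B → b ∈ B → a = b := fun ha hb =>
      hB.eq_of_reachableIn_compl ha hb hax hby
        (hr.mono (Set.compl_subset_compl.2 Set.subset_union_right))
    by_cases haS : a ∈ S
    · by_cases hbS : b ∈ S
      · exact hinv a haS b hbS x (fun h => hx (.inl h)) y (fun h => hy (.inl h)) hax hby
          (hr.mono (Set.compl_subset_compl.2 Set.subset_union_left))
      · have hbB : b ∈ B := hb.resolve_left hbS
        have := key b hbB hbS a haS y hy x hx hby hax hr.symm
        exact hblock (this ▸ hsB) hbB
    · have haB : a ∈ B := ha.resolve_left haS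
      refine hblock haB (hb.elim (fun hbS => ?_) id)
      exact key a haB haS b hbS x hx y hy hax hby hr ▸ hsB
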